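/- arXiv:1105.5490 — 3 statements merged into one kernel-verified Lean document; each statement's English description precedes it below -/
import Mathlib

section
/- Let G be a connected 3-regular finite simple graph that is not isomorphic to the complete graph K₄. Then G is a line graph if and only if for every vertex x of G, the subgraph induced on the neighborhood of x is isomorphic to the disjoint union K₁ ∪ K₂, i.e., among the three neighbors of x exactly one pair is adjacent. -/
open SimpleGraph Filter

attribute [local instance] Classical.propDecidable

lemma adjMatrix_isHermitian {V : Type} [Fintype V] [DecidableEq V] (G : SimpleGraph V)
    [DecidableRel G.Adj] : (G.adjMatrix ℝ).IsHermitian := by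
  rw [Matrix.IsHermitian, Matrix.conjTranspose_eq_transpose_of_trivial]
  exact G.isSymm_adjMatrix

/-- The smallest eigenvalue of the (real) adjacency matrix of a finite simple graph. -/
noncomputable def lambdaMin {V : Type} [Fintype V] (G : SimpleGraph V) : ℝ :=
  ⨅ i : V, (adjMatrix_isHermitian G).eigenvalues i

/-- `G` is a line graph if it is isomorphic to the line graph of some graph `H`. -/
def IsLineGraph {V : Type} (G : SimpleGraph V) : Prop :=
  ∃ (W : Type) (H : SimpleGraph W), Nonempty (G ≃g H.lineGraph)

/-- The disjoint union `K₁ ∪ K₂`, realized as the graph on three vertices whose only edge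
joins `0` and `1`. -/
def oneUnionTwo : SimpleGraph (Fin 3) := SimpleGraph.fromEdgeSet {s((0 : Fin 3), (1 : Fin 3))}

namespace SimpleGraph

variable {V : Type} {G : SimpleGraph V}

/-- The neighborhood of `x` induces `K₁ ∪ K₂` iff `x` has exactly three neighbors, of which
exactly one pair is adjacent. -/
lemma nonempty_induce_neighborSet_iso_oneUnionTwo_iff (x : V) :
    Nonempty (G.induce (G.neighborSet x) ≃g oneUnionTwo) ↔
      ∃ a b c, a ≠ b ∧ a ≠ c ∧ b ≠ c ∧ (∀ y, G.Adj x y ↔ y = a ∨ y = b ∨ y = c) ∧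
        G.Adj a b ∧ ¬ G.Adj a c ∧ ¬ G.Adj b c := by
  constructor
  · rintro ⟨φ⟩
    have adj_iff (i j : Fin 3) :
        G.Adj (φ.symm i) (φ.symm j) ↔ oneUnionTwo.Adj i j := φ.symm.map_adj_iff
    have inj (i j : Fin 3) (hij : i ≠ j) : (φ.symm i : V) ≠ φ.symm j :=
      fun h => hij (φ.symm.injective (Subtype.ext h))
    refine ⟨φ.symm 0, φ.symm 1, φ.symm 2, inj _ _ (by decide), inj _ _ (by decide),
      inj _ _ (by decide), fun y => ⟨fun hy => ?_, ?_⟩, ?_, ?_, ?_⟩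
    · have key : φ.symm (φ ⟨y, hy⟩) = ⟨y, hy⟩ := φ.symm_apply_apply _
      generalize φ ⟨y, hy⟩ = i at key
      fin_cases i <;> simp_all
    · rintro (rfl | rfl | rfl) <;> exact Subtype.property (φ.symm _)
    · exact (adj_iff 0 1).2 (by simp [oneUnionTwo])
    · exact fun hadj => absurd ((adj_iff 0 2).1 hadj) (by simp [oneUnionTwo])
    · exact fun hadj => absurd ((adj_iff 1 2).1 hadj) (by simp [oneUnionTwo])
  · rintro ⟨a, b, c, hab, hac, hbc, hx, h1, h2, h3⟩
    let f : Fin 3 → G.neighborSet x :=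
      ![⟨a, (hx a).2 (by simp)⟩, ⟨b, (hx b).2 (by simp)⟩, ⟨c, (hx c).2 (by simp)⟩]
    have hf : Function.Bijective f := by
      constructor
      · intro i j hij
        replace hij := congrArg Subtype.val hij
        fin_cases i <;> fin_cases j <;>
          simp [f, hab, hab.symm, hac, hac.symm, hbc, hbc.symm] at hij ⊢
      · rintro ⟨y, hy⟩
        rcases (hx y).1 hy with rfl | rfl | rfl
        exacts [⟨0, rfl⟩, ⟨1, rfl⟩, ⟨2, rfl⟩]
    refine ⟨RelIso.symm ⟨Equiv.ofBijective f hf, ?_⟩⟩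
    intro i j
    fin_cases i <;> fin_cases j <;>
      simp [f, oneUnionTwo, h1, h1.symm, h2, h3, mt Adj.symm h2, mt Adj.symm h3]

lemma IsRegularOfDegree.exists_adj_iff_of_three [G.LocallyFinite] (h : G.IsRegularOfDegree 3)
    (x : V) : ∃ a b c, a ≠ b ∧ a ≠ c ∧ b ≠ c ∧ ∀ y, G.Adj x y ↔ y = a ∨ y = b ∨ y = c := by
  obtain ⟨a, b, c, hab, hac, hbc, hN⟩ := Finset.card_eq_three.1 (h x)
  refine ⟨a, b, c, hab, hac, hbc, fun y => ?_⟩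
  rw [← mem_neighborFinset, hN]
  simp

/-- In a 3-regular graph, a vertex adjacent to three given distinct vertices has no others. -/
lemma IsRegularOfDegree.eq_or_eq_or_eq_of_adj [G.LocallyFinite] (h : G.IsRegularOfDegree 3)
    {x a b c y : V} (hab : a ≠ b) (hac : a ≠ c) (hbc : b ≠ c) (ha : G.Adj x a) (hb : G.Adj x b)
    (hc : G.Adj x c) (hy : G.Adj x y) : y = a ∨ y = b ∨ y = c := by
  obtain ⟨a', b', c', -, -, -, hx⟩ := h.exists_adj_iff_of_three x
  rw [hx] at ha hb hc hy
  grind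

/-- Every vertex of a 3-regular graph has a neighbor avoiding two given vertices. -/
lemma IsRegularOfDegree.exists_adj_ne_ne [G.LocallyFinite] (h : G.IsRegularOfDegree 3)
    (x y z : V) : ∃ w, G.Adj x w ∧ w ≠ y ∧ w ≠ z := by
  obtain ⟨a, b, c, hab, hac, hbc, hx⟩ := h.exists_adj_iff_of_three x
  by_contra! hcon
  have ha := hcon a ((hx a).2 (by simp))
  have hb := hcon b ((hx b).2 (by simp))
  have hc := hcon c ((hx c).2 (by simp))
  by_cases a = y <;> by_cases b = y <;> by_cases c = y <;> grind

lemma Connected.mem_of_adj_closed (hconn : G.Connected) {S : Set V}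
    (hS : ∀ v ∈ S, ∀ w, G.Adj v w → w ∈ S) {x : V} (hx : x ∈ S) (y : V) : y ∈ S := by
  obtain ⟨p⟩ := hconn.preconnected x y
  induction p with
  | nil => exact hx
  | cons h _ ih => exact ih (hS _ hx _ h)

/-- A connected 3-regular graph containing a 4-clique is `K₄`. -/
lemma Connected.nonempty_iso_top_of_four_clique [G.LocallyFinite] (hconn : G.Connected)
    (hreg : G.IsRegularOfDegree 3) {x a b c : V} (hxa : G.Adj x a) (hxb : G.Adj x b)
    (hxc : G.Adj x c) (hab : G.Adj a b) (hac : G.Adj a c) (hbc : G.Adj b c) :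
    Nonempty (G ≃g (⊤ : SimpleGraph (Fin 4))) := by
  have all : ∀ y, y ∈ ({x, a, b, c} : Set V) := by
    refine hconn.mem_of_adj_closed ?_ (Set.mem_insert x _)
    rintro v (rfl | rfl | rfl | rfl) w hw
    · have := hreg.eq_or_eq_or_eq_of_adj hab.ne hac.ne hbc.ne hxa hxb hxc hw
      simp; tauto
    · have := hreg.eq_or_eq_or_eq_of_adj hxb.ne hxc.ne hbc.ne hxa.symm hab hac hw
      simp; tauto
    · have := hreg.eq_or_eq_or_eq_of_adj hxa.ne hxc.ne hac.ne hxb.symm hab.symm hbc hw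
      simp; tauto
    · have := hreg.eq_or_eq_or_eq_of_adj hxa.ne hxb.ne hab.ne hxc.symm hac.symm hbc.symm hw
      simp; tauto
  let f : Fin 4 → V := ![x, a, b, c]
  have hadj (i j : Fin 4) : G.Adj (f i) (f j) ↔ (⊤ : SimpleGraph (Fin 4)).Adj i j := by
    fin_cases i <;> fin_cases j <;>
      simp [f, hxa, hxa.symm, hxb, hxb.symm, hxc, hxc.symm, hab, hab.symm, hac, hac.symm, hbc,
        hbc.symm]
  have hf : Function.Bijective f := by
    constructor
    · intro i j hij
      by_contra hne
      exact ((hadj i j).2 hne).ne hij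
    · intro y
      rcases all y with rfl | rfl | rfl | rfl
      exacts [⟨0, rfl⟩, ⟨1, rfl⟩, ⟨2, rfl⟩, ⟨3, rfl⟩]
  exact ⟨RelIso.symm ⟨Equiv.ofBijective f hf, fun {i j} => hadj i j⟩⟩

section Labelling

variable {W : Type} {f : V → Sym2 W}

/-- If a vertex `x` of a 3-regular line graph corresponds to the edge `pq`, and its neighbors
`a`, `b` correspond to edges through `p` and its neighbor `c` to an edge through `q`, then `a` and
`c` are not adjacent. -/
lemma IsRegularOfDegree.not_adj_of_labelling [G.LocallyFinite] (hreg : G.IsRegularOfDegree 3)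
    (hf : Function.Injective f) (hG : ∀ v w, G.Adj v w ↔ v ≠ w ∧ ∃ p, p ∈ f v ∧ p ∈ f w)
    {x a b c : V} {p q : W} (hpq : p ≠ q) (hx : f x = s(p, q)) (hab : a ≠ b) (hac : a ≠ c)
    (hbc : b ≠ c) (hN : ∀ y, G.Adj x y ↔ y = a ∨ y = b ∨ y = c)
    (hpa : p ∈ f a) (hpb : p ∈ f b) (hqc : q ∈ f c) : ¬ G.Adj a c := by
  intro hadj
  have hxa : G.Adj x a := (hN a).2 (by simp)
  have hxb : G.Adj x b := (hN b).2 (by simp)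
  have hxc : G.Adj x c := (hN c).2 (by simp)
  have eq_of_mem {v w : V} {s t : W} (hst : s ≠ t) (h1 : s ∈ f v) (h2 : t ∈ f v)
      (h3 : s ∈ f w) (h4 : t ∈ f w) : v = w :=
    hf (((Sym2.mem_and_mem_iff hst).1 ⟨h1, h2⟩).trans ((Sym2.mem_and_mem_iff hst).1 ⟨h3, h4⟩).symm)
  have hpx : p ∈ f x := by simp [hx]
  have hqx : q ∈ f x := by simp [hx]
  obtain ⟨-, r, hra, hrc⟩ := (hG a c).1 hadj
  have hpr : p ≠ r := by
    rintro rfl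
    exact hxc.ne (eq_of_mem hpq hpx hqx hrc hqc)
  have hqr : q ≠ r := by
    rintro rfl
    exact hxa.ne (eq_of_mem hpq hpx hqx hpa hra)
  have hc : f c = s(q, r) := (Sym2.mem_and_mem_iff hqr).1 ⟨hqc, hrc⟩
  obtain ⟨d, hcd, hdx, hda⟩ := hreg.exists_adj_ne_ne c x a
  obtain ⟨hdc, s, hsc, hsd⟩ := (hG c d).1 hcd
  rw [hc, Sym2.mem_iff] at hsc
  rcases hsc with rfl | rfl
  · rcases (hN d).1 ((hG x d).2 ⟨hdx.symm, s, hqx, hsd⟩) with rfl | rfl | rfl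
    · exact hda rfl
    · exact hxb.ne (eq_of_mem hpq hpx hqx hpb hsd)
    · exact hdc rfl
  · have hab' : G.Adj a b := (hG a b).2 ⟨hab, p, hpa, hpb⟩
    have had : G.Adj a d := (hG a d).2 ⟨hda.symm, s, hra, hsd⟩
    rcases hreg.eq_or_eq_or_eq_of_adj hxb.ne hxc.ne hbc hxa.symm hab' hadj had with rfl | rfl | rfl
    · exact hdx rfl
    · exact hab (eq_of_mem hpr hpa hra hpb hsd)
    · exact hdc rfl

lemma Connected.exists_neighbors_of_labelling [G.LocallyFinite] (hconn : G.Connected)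
    (hreg : G.IsRegularOfDegree 3) (hK4 : ¬ Nonempty (G ≃g (⊤ : SimpleGraph (Fin 4))))
    (hf : Function.Injective f) (hdiag : ∀ v, ¬ (f v).IsDiag)
    (hG : ∀ v w, G.Adj v w ↔ v ≠ w ∧ ∃ p, p ∈ f v ∧ p ∈ f w) (x : V) :
    ∃ a b c, a ≠ b ∧ a ≠ c ∧ b ≠ c ∧ (∀ y, G.Adj x y ↔ y = a ∨ y = b ∨ y = c) ∧
      G.Adj a b ∧ ¬ G.Adj a c ∧ ¬ G.Adj b c := by
  obtain ⟨p, q, hx⟩ : ∃ p q, f x = s(p, q) := by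
    induction h : f x with | _ p q => exact ⟨p, q, rfl⟩
  have hpq : p ≠ q := by simpa [hx] using hdiag x
  have not_all {p a b c} (hab : a ≠ b) (hac : a ≠ c) (hbc : b ≠ c)
      (hxa : G.Adj x a) (hxb : G.Adj x b) (hxc : G.Adj x c)
      (ha : p ∈ f a) (hb : p ∈ f b) (hc : p ∈ f c) : False :=
    hK4 (hconn.nonempty_iso_top_of_four_clique hreg hxa hxb hxc ((hG _ _).2 ⟨hab, p, ha, hb⟩)
      ((hG _ _).2 ⟨hac, p, ha, hc⟩) ((hG _ _).2 ⟨hbc, p, hb, hc⟩))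
  have split {p q a b c} (hpq : p ≠ q) (hx : f x = s(p, q)) (hab : a ≠ b) (hac : a ≠ c)
      (hbc : b ≠ c) (hN : ∀ y, G.Adj x y ↔ y = a ∨ y = b ∨ y = c)
      (ha : p ∈ f a) (hb : p ∈ f b) (hc : q ∈ f c) :
      ∃ a b c, a ≠ b ∧ a ≠ c ∧ b ≠ c ∧ (∀ y, G.Adj x y ↔ y = a ∨ y = b ∨ y = c) ∧
        G.Adj a b ∧ ¬ G.Adj a c ∧ ¬ G.Adj b c :=
    ⟨a, b, c, hab, hac, hbc, hN, (hG _ _).2 ⟨hab, p, ha, hb⟩,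
      hreg.not_adj_of_labelling hf hG hpq hx hab hac hbc hN ha hb hc,
      hreg.not_adj_of_labelling hf hG hpq hx hab.symm hbc hac (by grind) hb ha hc⟩
  obtain ⟨a, b, c, hab, hac, hbc, hN⟩ := hreg.exists_adj_iff_of_three x
  have hxa : G.Adj x a := (hN a).2 (by simp)
  have hxb : G.Adj x b := (hN b).2 (by simp)
  have hxc : G.Adj x c := (hN c).2 (by simp)
  have meets {y} (hy : G.Adj x y) : p ∈ f y ∨ q ∈ f y := by
    obtain ⟨-, s, hs, hsy⟩ := (hG x y).1 hy
    rw [hx, Sym2.mem_iff] at hs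
    rcases hs with rfl | rfl <;> simp [hsy]
  have hx' : f x = s(q, p) := hx.trans Sym2.eq_swap
  rcases meets hxa with ha | ha <;> rcases meets hxb with hb | hb <;>
    rcases meets hxc with hc | hc
  · exact (not_all hab hac hbc hxa hxb hxc ha hb hc).elim
  · exact split hpq hx hab hac hbc hN ha hb hc
  · exact split hpq hx hac hab hbc.symm (by grind) ha hc hb
  · exact split hpq.symm hx' hbc hab.symm hac.symm (by grind) hb hc ha
  · exact split hpq hx hbc hab.symm hac.symm (by grind) hb hc ha
  · exact split hpq.symm hx' hac hab hbc.symm (by grind) ha hc hb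
  · exact split hpq.symm hx' hab hac hbc hN ha hb hc
  · exact (not_all hab hac hbc hxa hxb hxc ha hb hc).elim

end Labelling

/-- If adjacency means lying in a common class of one of two equivalence relations that meet
trivially, then the graph is a line graph: join the two classes of every vertex by an edge. -/
lemma isLineGraph_of_setoids (r s : Setoid V) (hrs : ∀ v w, r v w → s v w → v = w)
    (hG : ∀ v w, G.Adj v w ↔ v ≠ w ∧ (r v w ∨ s v w)) : IsLineGraph G := by
  let f : V → Sym2 (Quotient r ⊕ Quotient s) :=
    fun v => s(Sum.inl (Quotient.mk r v), Sum.inr (Quotient.mk s v))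
  have hf : Function.Injective f := by
    intro v w h
    simp only [f, Sym2.eq_iff, Sum.inl.injEq, Sum.inr.injEq, reduceCtorEq, and_self,
      or_false] at h
    exact hrs v w (Quotient.exact h.1) (Quotient.exact h.2)
  have hedge : (fromEdgeSet (Set.range f)).edgeSet = Set.range f := by
    rw [edgeSet_fromEdgeSet, sdiff_eq_left, Set.disjoint_left]
    rintro _ ⟨v, rfl⟩
    simp [f]
  let e : V ≃ (fromEdgeSet (Set.range f)).edgeSet :=
    (Equiv.ofInjective f hf).trans (Equiv.setCongr hedge.symm)
  have he (v : V) : (e v : Sym2 (Quotient r ⊕ Quotient s)) = f v := rfl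
  refine ⟨_, fromEdgeSet (Set.range f), ⟨⟨e, fun {v w} => ?_⟩⟩⟩
  have hr : Quotient.mk r v = Quotient.mk r w ↔ r v w := Quotient.eq
  have hs : Quotient.mk s v = Quotient.mk s w ↔ s v w := Quotient.eq
  rw [lineGraph_adj_iff_exists, hG, he, he, e.injective.ne_iff, ← hr, ← hs]
  simp [f]

lemma isLineGraph_of_neighborhoods
    (h : ∀ x, ∃ a b c, a ≠ b ∧ a ≠ c ∧ b ≠ c ∧ (∀ y, G.Adj x y ↔ y = a ∨ y = b ∨ y = c) ∧
      G.Adj a b ∧ ¬ G.Adj a c ∧ ¬ G.Adj b c) : IsLineGraph G := by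
  have triangle_trans {u v w z z'} (huv : G.Adj v u) (hvw : G.Adj v w) (huz : G.Adj u z)
      (hvz : G.Adj v z) (hvz' : G.Adj v z') (hwz' : G.Adj w z') (huw : u ≠ w) : G.Adj u w := by
    obtain ⟨a, b, c, -, -, -, hN, hab, hac, hbc⟩ := h v
    rw [hN] at huv hvw hvz hvz'
    grind [SimpleGraph.adj_comm, SimpleGraph.irrefl]
  have mate_unique {u v w} (huv : G.Adj v u) (hvw : G.Adj v w)
      (hu : ∀ z, G.Adj u z → ¬ G.Adj v z) (hw : ∀ z, G.Adj v z → ¬ G.Adj w z) : u = w := by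
    obtain ⟨a, b, c, -, -, -, hN, hab, hac, hbc⟩ := h v
    have eq_mate {y} (hvy : G.Adj v y) (hy : ∀ z, G.Adj v z → ¬ G.Adj y z) : y = c := by
      rcases (hN y).1 hvy with rfl | rfl | rfl
      exacts [(hy b ((hN b).2 (by simp)) hab).elim, (hy a ((hN a).2 (by simp)) hab.symm).elim, rfl]
    exact (eq_mate huv fun z hv hu' => hu z hu' hv).trans (eq_mate hvw hw).symm
  let r : Setoid V :=
    { r := fun v w => v = w ∨ (G.Adj v w ∧ ∃ z, G.Adj v z ∧ G.Adj w z)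
      iseqv :=
        { refl := fun _ => Or.inl rfl
          symm := by
            rintro v w (rfl | ⟨hvw, z, hv, hw⟩)
            exacts [Or.inl rfl, Or.inr ⟨hvw.symm, z, hw, hv⟩]
          trans := by
            rintro u v w (rfl | ⟨huv, z, hu, hv⟩) (rfl | ⟨hvw, z', hv', hw⟩)
            · exact Or.inl rfl
            · exact Or.inr ⟨hvw, z', hv', hw⟩
            · exact Or.inr ⟨huv, z, hu, hv⟩
            · by_cases huw : u = w
              · exact Or.inl huw
              · exact Or.inr ⟨triangle_trans huv.symm hvw hu hv hv' hw huw, v, huv, hvw.symm⟩ } }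
  let s : Setoid V :=
    { r := fun v w => v = w ∨ (G.Adj v w ∧ ∀ z, G.Adj v z → ¬ G.Adj w z)
      iseqv :=
        { refl := fun _ => Or.inl rfl
          symm := by
            rintro v w (rfl | ⟨hvw, hz⟩)
            exacts [Or.inl rfl, Or.inr ⟨hvw.symm, fun z hw hv => hz z hv hw⟩]
          trans := by
            rintro u v w (rfl | ⟨huv, hu⟩) (rfl | ⟨hvw, hw⟩)
            · exact Or.inl rfl
            · exact Or.inr ⟨hvw, hw⟩
            · exact Or.inr ⟨huv, hu⟩
            · exact Or.inl (mate_unique huv.symm hvw hu hw) } }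
  refine isLineGraph_of_setoids r s ?_ ?_
  · rintro v w (rfl | ⟨-, z, hv, hw⟩) (h' | ⟨-, hz⟩)
    exacts [rfl, rfl, h', (hz z hv hw).elim]
  · intro v w
    constructor
    · intro hvw
      refine ⟨hvw.ne, ?_⟩
      by_cases hz : ∃ z, G.Adj v z ∧ G.Adj w z
      · exact Or.inl (Or.inr ⟨hvw, hz⟩)
      · exact Or.inr (Or.inr ⟨hvw, fun z hv hw => hz ⟨z, hv, hw⟩⟩)
    · rintro ⟨hne, (h' | h') | (h' | h')⟩
      exacts [(hne h').elim, h'.1, (hne h').elim, h'.1]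

end SimpleGraph

/-- A connected 3-regular graph other than `K₄` is a line graph iff the subgraph induced on
each neighborhood is isomorphic to `K₁ ∪ K₂`. -/
theorem stmt_10 {V : Type} [Fintype V] (G : SimpleGraph V) (hconn : G.Connected)
    (hreg : G.IsRegularOfDegree 3)
    (hK4 : ¬ Nonempty (G ≃g (⊤ : SimpleGraph (Fin 4)))) :
    IsLineGraph G ↔ ∀ x : V, Nonempty ((G.induce (G.neighborSet x)) ≃g oneUnionTwo) := by
  simp only [nonempty_induce_neighborSet_iso_oneUnionTwo_iff]
  refine ⟨?_, isLineGraph_of_neighborhoods⟩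
  rintro ⟨W, H, ⟨φ⟩⟩
  refine hconn.exists_neighbors_of_labelling hreg hK4 (f := fun v => (φ v : Sym2 W))
    (Subtype.val_injective.comp φ.injective)
    (fun v => H.not_isDiag_of_mem_edgeSet (φ v).property) fun v w => ?_
  rw [← φ.map_adj_iff, lineGraph_adj_iff_exists, φ.injective.ne_iff]
end

section
/- For every integer k ≥ 3 and every positive integer a, there exists a connected bipartite finite simple graph on a(2k−1) vertices with a bipartition into a part of size a(k−1), all of whose vertices have degree k, and a part of size ak, all of whose vertices have degree k−1 (i.e., a connected (k−1, k)-semi-regular graph on a(2k−1) vertices). -/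
open SimpleGraph Filter

attribute [local instance] Classical.propDecidable

/-- The shift on the first coordinate along the edge joining the `s`-th left vertex of a block
to a `t`-th right vertex: it is `1` for the one edge leaving the block, and `0` otherwise. -/
def blockShift (a : ℕ) {m n : ℕ} (s : Fin m) (t : Fin n) : ZMod a :=
  if s.val = 0 ∧ t.val = 0 then 1 else 0

/-- A cyclic chain of `a` complete bipartite graphs on `m + n` vertices, where in each block one
edge has been redirected to the next block. -/
def cyclicBlockGraph (a m n : ℕ) : SimpleGraph ((ZMod a × Fin m) ⊕ (ZMod a × Fin n)) where
  Adj
    | .inl p, .inr q => q.1 = p.1 + blockShift a p.2 q.2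
    | .inr q, .inl p => q.1 = p.1 + blockShift a p.2 q.2
    | _, _ => False
  symm := ⟨by rintro (p | p) (q | q) h <;> exact h⟩
  loopless := ⟨by rintro (p | p) h <;> exact h⟩

lemma cyclicBlockGraph_adj_inl_inr {a m n : ℕ} {p : ZMod a × Fin m} {q : ZMod a × Fin n} :
    (cyclicBlockGraph a m n).Adj (.inl p) (.inr q) ↔ q.1 = p.1 + blockShift a p.2 q.2 :=
  Iff.rfl

lemma cyclicBlockGraph_adj_inr_inl {a m n : ℕ} {p : ZMod a × Fin m} {q : ZMod a × Fin n} :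
    (cyclicBlockGraph a m n).Adj (.inr q) (.inl p) ↔ q.1 = p.1 + blockShift a p.2 q.2 :=
  Iff.rfl

lemma cyclicBlockGraph_not_adj_inl_inl {a m n : ℕ} {p p' : ZMod a × Fin m} :
    ¬ (cyclicBlockGraph a m n).Adj (.inl p) (.inl p') :=
  id

lemma cyclicBlockGraph_not_adj_inr_inr {a m n : ℕ} {q q' : ZMod a × Fin n} :
    ¬ (cyclicBlockGraph a m n).Adj (.inr q) (.inr q') :=
  id

lemma cyclicBlockGraph_degree_inl (a m n : ℕ) [NeZero a] (p : ZMod a × Fin m) :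
    (cyclicBlockGraph a m n).degree (.inl p) = n := by
  have h : (cyclicBlockGraph a m n).neighborFinset (.inl p) =
      Finset.univ.image fun t : Fin n ↦ Sum.inr (p.1 + blockShift a p.2 t, t) := by
    ext (q | q)
    · simp [cyclicBlockGraph_not_adj_inl_inl]
    · simp [cyclicBlockGraph_adj_inl_inr, Prod.ext_iff, eq_comm]
  rw [← card_neighborFinset_eq_degree, h, Finset.card_image_of_injective, Finset.card_fin]
  intro t t' ht
  simp_all

lemma cyclicBlockGraph_degree_inr (a m n : ℕ) [NeZero a] (q : ZMod a × Fin n) :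
    (cyclicBlockGraph a m n).degree (.inr q) = m := by
  have h : (cyclicBlockGraph a m n).neighborFinset (.inr q) =
      Finset.univ.image fun s : Fin m ↦ Sum.inl (q.1 - blockShift a s q.2, s) := by
    ext (p | p)
    · simp [cyclicBlockGraph_adj_inr_inl, Prod.ext_iff, sub_eq_iff_eq_add]
    · simp [cyclicBlockGraph_not_adj_inr_inr]
  rw [← card_neighborFinset_eq_degree, h, Finset.card_image_of_injective, Finset.card_fin]
  intro s s' hs
  simp_all

lemma cyclicBlockGraph_connected {a m n : ℕ} [NeZero a] (hm : 2 ≤ m) (hn : 2 ≤ n) :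
    (cyclicBlockGraph a m n).Connected := by
  let s₀ : Fin m := ⟨0, by omega⟩
  let s₁ : Fin m := ⟨1, by omega⟩
  let t₀ : Fin n := ⟨0, by omega⟩
  let t₁ : Fin n := ⟨1, by omega⟩
  have block (i : ZMod a) (s : Fin m) :
      (cyclicBlockGraph a m n).Reachable (.inl (i, s₀)) (.inl (i, s)) := by
    have h (s : Fin m) : (cyclicBlockGraph a m n).Adj (.inl (i, s)) (.inr (i, t₁)) := by
      simp [cyclicBlockGraph_adj_inl_inr, blockShift, t₁]
    exact (h s₀).reachable.trans (h s).symm.reachable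
  have step (i : ZMod a) :
      (cyclicBlockGraph a m n).Reachable (.inl (i, s₀)) (.inl (i + 1, s₀)) := by
    have h₀ : (cyclicBlockGraph a m n).Adj (.inl (i, s₀)) (.inr (i + 1, t₀)) := by
      simp [cyclicBlockGraph_adj_inl_inr, blockShift, s₀, t₀]
    have h₁ : (cyclicBlockGraph a m n).Adj (.inr (i + 1, t₀)) (.inl (i + 1, s₁)) := by
      simp [cyclicBlockGraph_adj_inr_inl, blockShift, s₁]
    exact (h₀.reachable.trans h₁.reachable).trans (block _ _).symm
  have chain (l : ℕ) :
      (cyclicBlockGraph a m n).Reachable (.inl (0, s₀)) (.inl ((l : ZMod a), s₀)) := by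
    induction l with
    | zero => simp
    | succ l ih => simpa using ih.trans (step l)
  have left (p : ZMod a × Fin m) :
      (cyclicBlockGraph a m n).Reachable (.inl (0, s₀)) (.inl p) := by
    have h := chain p.1.val
    rw [ZMod.natCast_zmod_val] at h
    exact h.trans (block _ _)
  rw [connected_iff_exists_forall_reachable]
  refine ⟨.inl (0, s₀), ?_⟩
  rintro (p | q)
  · exact left p
  · have h : (cyclicBlockGraph a m n).Adj
        (.inl (q.1 - blockShift a s₀ q.2, s₀)) (.inr q) := by
      simp [cyclicBlockGraph_adj_inl_inr]
    exact (left _).trans h.reachable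

/-- For every `k ≥ 3` and `a ≥ 1` there is a connected bipartite graph on `a(2k-1)` vertices
with one side of size `a(k-1)` all of degree `k` and the other side (of size `ak`) all of
degree `k-1`, i.e. a connected `(k-1, k)`-semi-regular graph on `a(2k-1)` vertices. -/
theorem stmt_11 (k a : ℕ) (hk : 3 ≤ k) (ha : 1 ≤ a) :
    ∃ G : SimpleGraph (Fin (a * (2 * k - 1))), G.Connected ∧
      ∃ S : Finset (Fin (a * (2 * k - 1))),
        S.card = a * (k - 1) ∧
        (∀ v ∈ S, G.degree v = k) ∧
        (∀ v ∉ S, G.degree v = k - 1) ∧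
        (∀ u v : Fin (a * (2 * k - 1)), G.Adj u v →
          ((u ∈ S ∧ v ∉ S) ∨ (u ∉ S ∧ v ∈ S))) := by
  have : NeZero a := ⟨by omega⟩
  have hcard : Fintype.card ((ZMod a × Fin (k - 1)) ⊕ (ZMod a × Fin k)) = a * (2 * k - 1) := by
    simp only [Fintype.card_sum, Fintype.card_prod, ZMod.card, Fintype.card_fin, ← mul_add]
    congr 1
    omega
  let e := Fintype.equivFinOfCardEq hcard
  let φ : cyclicBlockGraph a (k - 1) k ≃g (cyclicBlockGraph a (k - 1) k).map e.toEmbedding :=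
    Iso.map e _
  refine ⟨(cyclicBlockGraph a (k - 1) k).map e.toEmbedding,
    φ.connected_iff.mp (cyclicBlockGraph_connected (by omega) (by omega)),
    Finset.univ.map (Function.Embedding.inl.trans e.toEmbedding), ?_, ?_, ?_, ?_⟩
  · simp [ZMod.card]
  · intro v hv
    obtain ⟨p, -, rfl⟩ := Finset.mem_map.mp hv
    convert (φ.degree_eq (.inl p)).trans (cyclicBlockGraph_degree_inl ..)
    rfl
  · intro v hv
    obtain ⟨p | q, rfl⟩ := e.surjective v
    · simp at hv
    · convert (φ.degree_eq (.inr q)).trans (cyclicBlockGraph_degree_inr ..)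
      rfl
  · intro u v huv
    obtain ⟨x, rfl⟩ := e.surjective u
    obtain ⟨y, rfl⟩ := e.surjective v
    have hxy : (cyclicBlockGraph a (k - 1) k).Adj x y := φ.map_adj_iff.mp huv
    rcases x with p | p <;> rcases y with q | q
    · exact (cyclicBlockGraph_not_adj_inl_inl hxy).elim
    · simp
    · simp
    · exact (cyclicBlockGraph_not_adj_inr_inr hxy).elim
end

section
/- For every integer k ≥ 3 there exists a connected k-regular finite simple graph whose smallest adjacency eigenvalue equals −1−√2. -/
open SimpleGraph Filter

attribute [local instance] Classical.propDecidable

/-- The graph on `α × β × Option Bool` whose edges are those of the disjoint paths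
`(i, j, some false)`, `(i, j, none)`, `(i, j, some true)` together with those of the disjoint
cliques `{(i, j, none) | i}` and `{(i, j, some s) | j}`. -/
def pathCliqueGraph (α β : Type) : SimpleGraph (α × β × Option Bool) where
  Adj
    | (i, j, none), (i', j', none) => i ≠ i' ∧ j = j'
    | (i, j, some s), (i', j', some t) => i = i' ∧ j ≠ j' ∧ s = t
    | (i, j, none), (i', j', some _) => i = i' ∧ j = j'
    | (i, j, some _), (i', j', none) => i = i' ∧ j = j'
  symm := ⟨by
    rintro ⟨i, j, _ | s⟩ ⟨i', j', _ | t⟩ h <;> simp_all [eq_comm]⟩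
  loopless := ⟨by
    rintro ⟨i, j, _ | s⟩ h <;> simp_all⟩

namespace pathCliqueGraph

variable {α β : Type}

lemma adj_none_none {i i' : α} {j j' : β} :
    (pathCliqueGraph α β).Adj (i, j, none) (i', j', none) ↔ i ≠ i' ∧ j = j' := Iff.rfl

lemma adj_some_some {i i' : α} {j j' : β} {s t : Bool} :
    (pathCliqueGraph α β).Adj (i, j, some s) (i', j', some t) ↔ i = i' ∧ j ≠ j' ∧ s = t := Iff.rfl

lemma adj_none_some {i i' : α} {j j' : β} {t : Bool} :
    (pathCliqueGraph α β).Adj (i, j, none) (i', j', some t) ↔ i = i' ∧ j = j' := Iff.rfl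

lemma adj_some_none {i i' : α} {j j' : β} {s : Bool} :
    (pathCliqueGraph α β).Adj (i, j, some s) (i', j', none) ↔ i = i' ∧ j = j' := Iff.rfl

lemma connected [Nonempty α] [Nonempty β] : (pathCliqueGraph α β).Connected := by
  have center (i : α) (j : β) (s : Option Bool) :
      (pathCliqueGraph α β).Reachable (i, j, s) (i, j, none) := by
    rcases s with _ | s
    · exact .rfl
    · exact Adj.reachable (adj_some_none.2 ⟨rfl, rfl⟩)
  have left (i i' : α) (j : β) :
      (pathCliqueGraph α β).Reachable (i, j, none) (i', j, none) := by
    by_cases h : i = i'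
    · rw [h]
    · exact Adj.reachable (adj_none_none.2 ⟨h, rfl⟩)
  have right (i : α) (j j' : β) :
      (pathCliqueGraph α β).Reachable (i, j, some true) (i, j', some true) := by
    by_cases h : j = j'
    · rw [h]
    · exact Adj.reachable (adj_some_some.2 ⟨rfl, h, rfl⟩)
  refine (connected_iff _).2 ⟨?_, inferInstance⟩
  rintro ⟨i, j, s⟩ ⟨i', j', s'⟩
  exact (center i j s).trans <| (left i i' j).trans <| (center i' j (some true)).symm.trans <|
    (right i' j j').trans <| (center i' j' (some true)).trans (center i' j' s').symm

variable [Fintype α] [Fintype β]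

lemma adjMatrix_mulVec_none (y : α × β × Option Bool → ℝ) (i : α) (j : β) :
    ((pathCliqueGraph α β).adjMatrix ℝ).mulVec y (i, j, none) =
      ∑ i', y (i', j, none) - y (i, j, none) + (y (i, j, some false) + y (i, j, some true)) := by
  have h (i' : α) : (if i = i' then 0 else y (i', j, none)) =
      y (i', j, none) - if i = i' then y (i', j, none) else 0 := by
    split_ifs <;> simp_all
  simp [Matrix.mulVec, dotProduct, Fintype.sum_prod_type, Fintype.sum_option, adj_none_none,
    adj_none_some, ite_and, Finset.sum_add_distrib, h]
  ring

lemma adjMatrix_mulVec_some (y : α × β × Option Bool → ℝ) (i : α) (j : β) (s : Bool) :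
    ((pathCliqueGraph α β).adjMatrix ℝ).mulVec y (i, j, some s) =
      ∑ j', y (i, j', some s) - y (i, j, some s) + y (i, j, none) := by
  have h (j' : β) : (if j = j' then 0 else y (i, j', some s)) =
      y (i, j', some s) - if j = j' then y (i, j', some s) else 0 := by
    split_ifs <;> simp_all
  cases s <;>
  simp [Matrix.mulVec, dotProduct, Fintype.sum_prod_type, Fintype.sum_option, adj_some_some,
    adj_some_none, ite_and, Finset.sum_add_distrib, h] <;>
  ring

lemma isRegularOfDegree (hαβ : Fintype.card β = Fintype.card α + 1) :
    (pathCliqueGraph α β).IsRegularOfDegree (Fintype.card β) := by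
  have hdeg (v : α × β × Option Bool) :=
    (pathCliqueGraph α β).adjMatrix_mulVec_const_apply (α := ℝ) (a := 1) (v := v)
  rintro ⟨i, j, _ | s⟩
  · have := hdeg (i, j, none)
    rw [adjMatrix_mulVec_none] at this
    have hc : (Fintype.card β : ℝ) = Fintype.card α + 1 := by exact_mod_cast hαβ
    simp at this
    have h : ((pathCliqueGraph α β).degree (i, j, none) : ℝ) = Fintype.card β := by linarith
    exact_mod_cast h
  · have := hdeg (i, j, some s)
    rw [adjMatrix_mulVec_some] at this
    simp at this
    exact this.symm

lemma dotProduct_adjMatrix_mulVec (y : α × β × Option Bool → ℝ) :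
    (-1 - √2) * (y ⬝ᵥ y) ≤ y ⬝ᵥ ((pathCliqueGraph α β).adjMatrix ℝ).mulVec y := by
  have hq : y ⬝ᵥ ((pathCliqueGraph α β).adjMatrix ℝ).mulVec y - (-1 - √2) * (y ⬝ᵥ y) =
      ∑ j, (∑ i, y (i, j, none)) ^ 2 + ∑ i, (∑ j, y (i, j, some false)) ^ 2 +
      ∑ i, (∑ j, y (i, j, some true)) ^ 2 +
      ∑ i, ∑ j, (√2 * (y (i, j, none) ^ 2 + y (i, j, some false) ^ 2 + y (i, j, some true) ^ 2) +
        2 * y (i, j, none) * (y (i, j, some false) + y (i, j, some true))) := by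
    have hn : ∑ j, (∑ i, y (i, j, none)) ^ 2 =
        ∑ i, ∑ j, y (i, j, none) * ∑ i', y (i', j, none) := by
      rw [Finset.sum_comm]
      simp only [sq, Finset.sum_mul]
    have hs (s : Bool) : ∑ i, (∑ j, y (i, j, some s)) ^ 2 =
        ∑ i, ∑ j, y (i, j, some s) * ∑ j', y (i, j', some s) := by
      simp only [sq, Finset.sum_mul]
    rw [hn, hs, hs]
    simp only [dotProduct, Fintype.sum_prod_type, Fintype.sum_option, Fintype.sum_bool,
      adjMatrix_mulVec_none, adjMatrix_mulVec_some, Finset.mul_sum (s := Finset.univ) (a := -1 - √2),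
      ← Finset.sum_add_distrib, ← Finset.sum_sub_distrib]
    refine Finset.sum_congr rfl fun i _ ↦ Finset.sum_congr rfl fun j _ ↦ ?_
    ring
  have hblock (a b c : ℝ) : 0 ≤ √2 * (a ^ 2 + b ^ 2 + c ^ 2) + 2 * a * (b + c) := by
    have h2 : √2 ^ 2 = 2 := Real.sq_sqrt (by norm_num)
    have : √2 * (a ^ 2 + b ^ 2 + c ^ 2) + 2 * a * (b + c) =
        √2 / 2 * ((√2 * a + (b + c)) ^ 2 + (b - c) ^ 2) := by
      linear_combination (-(√2 / 2) * a ^ 2 - a * (b + c)) * h2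
    rw [this]
    positivity
  have : 0 ≤ y ⬝ᵥ ((pathCliqueGraph α β).adjMatrix ℝ).mulVec y - (-1 - √2) * (y ⬝ᵥ y) := by
    rw [hq]
    have := Finset.sum_nonneg fun i (_ : i ∈ Finset.univ) ↦ Finset.sum_nonneg
      fun j (_ : j ∈ Finset.univ) ↦
        hblock (y (i, j, none)) (y (i, j, some false)) (y (i, j, some true))
    positivity
  linarith

lemma exists_eigenvector [Nontrivial α] [Nontrivial β] :
    ∃ y ≠ 0, ((pathCliqueGraph α β).adjMatrix ℝ).mulVec y = (-1 - √2) • y := by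
  have sum_zero (γ : Type) [Fintype γ] [Nontrivial γ] : ∃ u : γ → ℝ, u ≠ 0 ∧ ∑ i, u i = 0 := by
    obtain ⟨a, b, hab⟩ := exists_pair_ne γ
    refine ⟨Pi.single a 1 - Pi.single b 1, fun h ↦ ?_, by simp⟩
    simpa [hab] using congrFun h a
  obtain ⟨u, hu, hu0⟩ := sum_zero α
  obtain ⟨v, hv, hv0⟩ := sum_zero β
  obtain ⟨i₀, hi⟩ := Function.ne_iff.1 hu
  obtain ⟨j₀, hj⟩ := Function.ne_iff.1 hv
  have h2 : √2 ^ 2 = 2 := Real.sq_sqrt (by norm_num)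
  refine ⟨fun p ↦ p.2.2.elim (-√2) (fun _ ↦ 1) * (u p.1 * v p.2.1), fun h ↦ ?_, ?_⟩
  · have := congrFun h (i₀, j₀, some true)
    simp_all
  · ext ⟨i, j, _ | s⟩
    · rw [adjMatrix_mulVec_none]
      simp only [Option.elim, ← Finset.mul_sum, ← Finset.sum_mul, hu0, Pi.smul_apply, smul_eq_mul]
      linear_combination -(u i * v j) * h2
    · rw [adjMatrix_mulVec_some]
      simp only [Option.elim, ← Finset.mul_sum, hv0, Pi.smul_apply, smul_eq_mul]
      ring

end pathCliqueGraph

lemma lambdaMin_eq_sInf_spectrum {V : Type} [Fintype V] (G : SimpleGraph V) :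
    lambdaMin G = sInf (spectrum ℝ (G.adjMatrix ℝ)) := by
  rw [(adjMatrix_isHermitian G).spectrum_real_eq_range_eigenvalues]
  rfl

lemma SimpleGraph.Iso.lambdaMin_eq {V W : Type} [Fintype V] [Fintype W] {G : SimpleGraph V}
    {H : SimpleGraph W} (e : G ≃g H) : lambdaMin G = lambdaMin H := by
  have h : Matrix.reindexAlgEquiv ℝ ℝ e.toEquiv (G.adjMatrix ℝ) = H.adjMatrix ℝ := by
    ext v w
    exact if_congr e.symm.map_adj_iff rfl rfl
  rw [lambdaMin_eq_sInf_spectrum, lambdaMin_eq_sInf_spectrum, ← h, AlgEquiv.spectrum_eq]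

lemma lambdaMin_eq_of_eigenvector {V : Type} [Fintype V] (G : SimpleGraph V) (c : ℝ)
    (hle : ∀ y : V → ℝ, c * (y ⬝ᵥ y) ≤ y ⬝ᵥ (G.adjMatrix ℝ).mulVec y)
    (hex : ∃ y ≠ 0, (G.adjMatrix ℝ).mulVec y = c • y) : lambdaMin G = c := by
  have hmem (μ : ℝ) : μ ∈ spectrum ℝ (G.adjMatrix ℝ) ↔
      ∃ y ≠ 0, (G.adjMatrix ℝ).mulVec y = μ • y := by
    rw [← Matrix.spectrum_toLin', ← Module.End.hasEigenvalue_iff_mem_spectrum]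
    constructor
    · intro h
      obtain ⟨y, hy⟩ := h.exists_hasEigenvector
      exact ⟨y, hy.2, by simpa using hy.apply_eq_smul⟩
    · rintro ⟨y, hy, h⟩
      exact Module.End.hasEigenvalue_of_hasEigenvector
        (Module.End.hasEigenvector_iff.2 ⟨Module.End.mem_eigenspace_iff.2 (by simpa using h), hy⟩)
  rw [lambdaMin_eq_sInf_spectrum]
  refine IsLeast.csInf_eq ⟨(hmem c).2 hex, fun μ hμ ↦ ?_⟩
  obtain ⟨y, hy, h⟩ := (hmem μ).1 hμ
  have hy' := hle y
  rw [h, dotProduct_smul, smul_eq_mul] at hy'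
  have hpos : 0 < y ⬝ᵥ y :=
    lt_of_le_of_ne (Finset.sum_nonneg fun i _ ↦ mul_self_nonneg (y i))
      (Ne.symm (mt dotProduct_self_eq_zero.1 hy))
  exact le_of_mul_le_mul_right hy' hpos

/-- For every `k ≥ 3` there is a connected `k`-regular graph with smallest adjacency
eigenvalue exactly `-1-√2`. -/
theorem stmt_12 (k : ℕ) (hk : 3 ≤ k) :
    ∃ (n : ℕ) (G : SimpleGraph (Fin n)), G.Connected ∧ G.IsRegularOfDegree k ∧
      lambdaMin G = -1 - Real.sqrt 2 := by
  obtain ⟨m, rfl⟩ := Nat.exists_eq_add_of_le' hk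
  let H := pathCliqueGraph (Fin (m + 2)) (Fin (m + 3))
  let e : H ≃g H.overFin rfl := H.overFinIso rfl
  refine ⟨_, H.overFin rfl, e.connected_iff.1 pathCliqueGraph.connected, fun v ↦ ?_, ?_⟩
  · obtain ⟨w, rfl⟩ := e.surjective v
    have := pathCliqueGraph.isRegularOfDegree (α := Fin (m + 2)) (β := Fin (m + 3)) (by simp) w
    rw [e.degree_eq]
    simpa using this
  · rw [← e.lambdaMin_eq]
    exact lambdaMin_eq_of_eigenvector H _ pathCliqueGraph.dotProduct_adjMatrix_mulVec
      pathCliqueGraph.exists_eigenvector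
end
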